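/- Let α, β > -1/2 and let G̃_N be the N×N Gram matrix [G̃_N]_{ℓ,k} = ∫_{-1}^1 P_{ℓ-1}^{(α,β)}(x) P_{k-1}^{(α,β)}(x) (ω_{α,β}(x))² dx. Then G̃_N is symmetric positive definite and its largest eigenvalue satisfies λ_max(G̃_N) ≤ C(α,β)(1 + log N) for a constant C(α,β) > 0 independent of N. -/

import Mathlib

/-- The Jacobi polynomial `P_n^{(a,b)}` via its explicit hypergeometric sum. -/
noncomputable def jacobiP (n : ℕ) (a b : ℝ) (x : ℝ) : ℝ :=
  Real.Gamma (a + n + 1) / ((n.factorial : ℝ) * Real.Gamma (a + b + n + 1)) *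
    ∑ m ∈ Finset.range (n + 1),
      (n.choose m : ℝ) * (Real.Gamma (a + b + n + m + 1) / Real.Gamma (a + m + 1)) *
        ((x - 1) / 2) ^ m

/-- The Jacobi weight `ω_{a,b}(t) = (1-t)^a (1+t)^b`. -/
noncomputable def jacobiW (a b t : ℝ) : ℝ := (1 - t) ^ a * (1 + t) ^ b

/-- The Gram matrix `G̃_N` of the Jacobi polynomials with respect to the squared weight. -/
noncomputable def gramG (α β : ℝ) (N : ℕ) : Matrix (Fin N) (Fin N) ℝ :=
  Matrix.of fun l k =>
    ∫ t in (-1 : ℝ)..1, jacobiP l α β t * jacobiP k α β t * (jacobiW α β t) ^ 2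

section

open Polynomial

/-- The integral of a polynomial against the beta weight `s ^ p * (1 - s) ^ r` on `(0, 1)`. -/
noncomputable def betaMoment (p r : ℝ) (q : ℝ[X]) : ℝ :=
  ∫ s in (0 : ℝ)..1, s ^ p * (1 - s) ^ r * q.eval s

theorem intervalIntegrable_beta {p r : ℝ} (hp : -1 < p) (hr : -1 < r) :
    IntervalIntegrable (fun s : ℝ => s ^ p * (1 - s) ^ r) MeasureTheory.volume 0 1 := by
  have left_half {p r : ℝ} (hp : -1 < p) :
      IntervalIntegrable (fun s : ℝ => s ^ p * (1 - s) ^ r) MeasureTheory.volume 0 (1 / 2) := by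
    refine (intervalIntegral.intervalIntegrable_rpow' hp).mul_continuousOn ?_
    intro s hs
    rw [Set.uIcc_of_le (by norm_num)] at hs
    refine ContinuousAt.continuousWithinAt ?_
    exact ContinuousAt.rpow_const (by fun_prop) (Or.inl (by linarith [hs.2]))
  refine (left_half hp).trans ?_
  have h := ((left_half (p := r) (r := p) hr).comp_sub_left 1).symm
  norm_num at h
  simpa only [mul_comm, one_div] using h

theorem intervalIntegrable_beta_mul_eval {p r : ℝ} (hp : -1 < p) (hr : -1 < r) (q : ℝ[X]) :
    IntervalIntegrable (fun s : ℝ => s ^ p * (1 - s) ^ r * q.eval s) MeasureTheory.volume 0 1 :=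
  (intervalIntegrable_beta hp hr).mul_continuousOn q.continuous.continuousOn

theorem betaMoment_add {p r : ℝ} (hp : -1 < p) (hr : -1 < r) (q₁ q₂ : ℝ[X]) :
    betaMoment p r (q₁ + q₂) = betaMoment p r q₁ + betaMoment p r q₂ := by
  simp only [betaMoment, eval_add, mul_add]
  exact intervalIntegral.integral_add (intervalIntegrable_beta_mul_eval hp hr q₁)
    (intervalIntegrable_beta_mul_eval hp hr q₂)

theorem betaMoment_C_mul (p r c : ℝ) (q : ℝ[X]) :
    betaMoment p r (C c * q) = c * betaMoment p r q := by
  simp only [betaMoment, eval_mul, eval_C, ← intervalIntegral.integral_const_mul]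
  congr 1
  ext s
  ring

theorem betaMoment_sum {p r : ℝ} (hp : -1 < p) (hr : -1 < r) {ι : Type*} (t : Finset ι)
    (q : ι → ℝ[X]) : betaMoment p r (∑ i ∈ t, q i) = ∑ i ∈ t, betaMoment p r (q i) := by
  simp only [betaMoment, eval_finsetSum, Finset.mul_sum]
  exact intervalIntegral.integral_finsetSum fun i _ => intervalIntegrable_beta_mul_eval hp hr (q i)

/-- Comparison of beta moments from a pointwise comparison on the open interval. -/
theorem betaMoment_le_betaMoment {p r p' r' : ℝ} (hp : -1 < p) (hr : -1 < r) (hp' : -1 < p')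
    (hr' : -1 < r') {q q' : ℝ[X]}
    (h : ∀ s ∈ Set.Ioo (0 : ℝ) 1,
      s ^ p * (1 - s) ^ r * q.eval s ≤ s ^ p' * (1 - s) ^ r' * q'.eval s) :
    betaMoment p r q ≤ betaMoment p' r' q' :=
  intervalIntegral.integral_mono_on_of_le_Ioo zero_le_one
    (intervalIntegrable_beta_mul_eval hp hr q) (intervalIntegrable_beta_mul_eval hp' hr' q') h

theorem betaMoment_X_mul_one_sub_X_mul (p r : ℝ) (q : ℝ[X]) :
    betaMoment p r (X * (1 - X) * q) = betaMoment (p + 1) (r + 1) q := by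
  rw [betaMoment, betaMoment, intervalIntegral.integral_of_le zero_le_one,
    intervalIntegral.integral_of_le zero_le_one, MeasureTheory.integral_Ioc_eq_integral_Ioo,
    MeasureTheory.integral_Ioc_eq_integral_Ioo]
  refine MeasureTheory.setIntegral_congr_fun measurableSet_Ioo fun s hs => ?_
  have h0 : s ≠ 0 := hs.1.ne'
  have h1 : 1 - s ≠ 0 := by linarith [hs.2]
  simp only [eval_mul, eval_X, eval_sub, eval_one, Real.rpow_add_one h0, Real.rpow_add_one h1]
  ring

theorem betaMoment_one {p r : ℝ} (hp : -1 < p) (hr : -1 < r) :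
    betaMoment p r 1 = Real.Gamma (p + 1) * Real.Gamma (r + 1) / Real.Gamma (p + r + 2) := by
  have h := ProbabilityTheory.beta_eq_betaIntegralReal (p + 1) (r + 1) (by linarith) (by linarith)
  rw [ProbabilityTheory.beta, show p + 1 + (r + 1) = p + r + 2 by ring] at h
  rw [h, Complex.betaIntegral, betaMoment]
  have hcast : Set.EqOn (fun x : ℝ => (x : ℂ) ^ (((p + 1 : ℝ) : ℂ) - 1) *
      (1 - (x : ℂ)) ^ (((r + 1 : ℝ) : ℂ) - 1))
      (fun x : ℝ => ((x ^ p * (1 - x) ^ r : ℝ) : ℂ)) (Set.uIcc 0 1) := by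
    intro x hx
    rw [Set.uIcc_of_le zero_le_one] at hx
    have h1 : 0 ≤ 1 - x := by linarith [hx.2]
    simp only [Complex.ofReal_mul, Complex.ofReal_cpow hx.1, Complex.ofReal_cpow h1]
    push_cast
    simp
  rw [intervalIntegral.integral_congr hcast, intervalIntegral.integral_ofReal, Complex.ofReal_re]
  simp

/-- The derivative of `s ^ (p + 1) * (1 - s) ^ (r + 1) * q` has integral zero over `(0, 1)`. -/
theorem betaMoment_integration_by_parts {p r : ℝ} (hp : -1 < p) (hr : -1 < r) (q : ℝ[X]) :
    betaMoment p r
      ((C (p + 1) * (1 - X) - C (r + 1) * X) * q + X * (1 - X) * derivative q) = 0 := by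
  have hp' : 0 < p + 1 := by linarith
  have hr' : 0 < r + 1 := by linarith
  have key := intervalIntegral.integral_eq_sub_of_hasDerivAt_of_le
    (f := fun s : ℝ => s ^ (p + 1) * (1 - s) ^ (r + 1) * q.eval s) zero_le_one ?_ ?_
    (intervalIntegrable_beta_mul_eval hp hr
      ((C (p + 1) * (1 - X) - C (r + 1) * X) * q + X * (1 - X) * derivative q))
  · rw [betaMoment, key]
    simp [Real.zero_rpow hp'.ne', Real.zero_rpow hr'.ne']
  · refine ((ContinuousOn.rpow_const continuousOn_id fun _ _ => Or.inr hp'.le).mul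
      (ContinuousOn.rpow_const (by fun_prop) fun _ _ => Or.inr hr'.le)).mul
        q.continuous.continuousOn
  · intro s hs
    have h0 : s ≠ 0 := hs.1.ne'
    have h1 : 1 - s ≠ 0 := by linarith [hs.2]
    have d0 := (hasDerivAt_id s).rpow_const (p := p + 1) (Or.inl h0)
    have d1 := ((hasDerivAt_id s).const_sub 1).rpow_const (p := r + 1) (Or.inl h1)
    refine ((d0.mul d1).mul (q.hasDerivAt s)).congr_deriv ?_
    simp only [eval_mul, eval_X, eval_sub, eval_one, eval_add, eval_C, Real.rpow_add_one h0,
      Real.rpow_add_one h1, add_sub_cancel_right, id, Pi.mul_apply]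
    ring

/-- The Jacobi polynomial in the variable `s = (1 - x) / 2`. -/
noncomputable def jacobiPoly (n : ℕ) (a b : ℝ) : ℝ[X] :=
  ∑ m ∈ Finset.range (n + 1),
    C (Real.Gamma (a + n + 1) / ((n.factorial : ℝ) * Real.Gamma (a + b + n + 1)) *
      ((n.choose m : ℝ) * (Real.Gamma (a + b + n + m + 1) / Real.Gamma (a + m + 1)) *
        (-1) ^ m)) * X ^ m

theorem jacobiP_eq_eval_jacobiPoly (n : ℕ) (a b x : ℝ) :
    jacobiP n a b x = (jacobiPoly n a b).eval ((1 - x) / 2) := by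
  simp only [jacobiP, jacobiPoly, eval_finsetSum, eval_mul, eval_C, eval_pow, eval_X,
    Finset.mul_sum]
  refine Finset.sum_congr rfl fun m _ => ?_
  rw [show (x - 1) / 2 = -1 * ((1 - x) / 2) by ring, mul_pow]
  ring

theorem coeff_jacobiPoly (n : ℕ) (a b : ℝ) (m : ℕ) :
    (jacobiPoly n a b).coeff m =
      Real.Gamma (a + n + 1) / ((n.factorial : ℝ) * Real.Gamma (a + b + n + 1)) *
        ((n.choose m : ℝ) * (Real.Gamma (a + b + n + m + 1) / Real.Gamma (a + m + 1)) *
          (-1) ^ m) := by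
  simp only [jacobiPoly, finsetSum_coeff, coeff_C_mul_X_pow, Finset.sum_ite_eq, Finset.mem_range]
  split_ifs with h
  · rfl
  · rw [Nat.choose_eq_zero_of_lt (by omega)]
    simp

theorem natDegree_jacobiPoly_le (n : ℕ) (a b : ℝ) : (jacobiPoly n a b).natDegree ≤ n := by
  rw [natDegree_le_iff_coeff_eq_zero]
  intro m hm
  rw [coeff_jacobiPoly, Nat.choose_eq_zero_of_lt hm]
  simp

theorem degree_jacobiPoly {a b : ℝ} (ha : -1 < a) (hab : -1 < a + b) (n : ℕ) :
    (jacobiPoly n a b).degree = n := by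
  refine degree_eq_of_le_of_coeff_ne_zero
    (natDegree_le_iff_degree_le.1 (natDegree_jacobiPoly_le n a b)) ?_
  have hn : (0 : ℝ) ≤ n := n.cast_nonneg
  have h1 := Real.Gamma_pos_of_pos (show 0 < a + n + 1 by linarith)
  have h2 := Real.Gamma_pos_of_pos (show 0 < a + b + n + 1 by linarith)
  have h3 := Real.Gamma_pos_of_pos (show 0 < a + b + n + n + 1 by linarith)
  rw [coeff_jacobiPoly, Nat.choose_self]
  have : (n.factorial : ℝ) ≠ 0 := by exact_mod_cast n.factorial_ne_zero
  positivity

theorem coeff_X_mul_derivative (p : ℝ[X]) (m : ℕ) :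
    (X * derivative p).coeff m = m * p.coeff m := by
  cases m with
  | zero => simp
  | succ m => rw [coeff_X_mul, coeff_derivative]; push_cast; ring

theorem coeff_jacobiPoly_succ {a b : ℝ} (ha : -1 < a) (hab : -1 < a + b) (n m : ℕ) :
    (m + 1) * (a + m + 1) * (jacobiPoly n a b).coeff (m + 1) =
      (m - n) * (a + b + n + m + 1) * (jacobiPoly n a b).coeff m := by
  have hm : (0 : ℝ) ≤ m := m.cast_nonneg
  have hn : (0 : ℝ) ≤ n := n.cast_nonneg
  have hpos : 0 < a + m + 1 := by linarith
  have g1 := (Real.Gamma_pos_of_pos hpos).ne'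
  have e1 : Real.Gamma (a + (m + 1 : ℕ) + 1) = (a + m + 1) * Real.Gamma (a + m + 1) := by
    rw [← Real.Gamma_add_one hpos.ne']; push_cast; ring_nf
  have e2 : Real.Gamma (a + b + n + (m + 1 : ℕ) + 1) =
      (a + b + n + m + 1) * Real.Gamma (a + b + n + m + 1) := by
    rw [← Real.Gamma_add_one (by linarith)]; push_cast; ring_nf
  have hc : (n.choose (m + 1) : ℝ) * (m + 1) = n.choose m * (n - m) := by
    rcases le_or_gt m n with h | h
    · rw [← Nat.cast_sub h]; exact_mod_cast Nat.choose_succ_right_eq n m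
    · simp [Nat.choose_eq_zero_of_lt h, Nat.choose_eq_zero_of_lt (h.trans (Nat.lt_succ_self m))]
  rw [coeff_jacobiPoly, coeff_jacobiPoly, e1, e2, pow_succ]
  generalize Real.Gamma (a + n + 1) / ((n.factorial : ℝ) * Real.Gamma (a + b + n + 1)) = K
  field_simp
  linear_combination (-K * Real.Gamma (a + b + n + m + 1) * (a + b + n + m + 1)) * hc

/-- The Jacobi differential equation in the variable `s = (1 - x) / 2`. -/
theorem jacobiPoly_differential_equation {a b : ℝ} (ha : -1 < a) (hab : -1 < a + b) (n : ℕ) :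
    X * (1 - X) * derivative (derivative (jacobiPoly n a b)) +
      (C (a + 1) * (1 - X) - C (b + 1) * X) * derivative (jacobiPoly n a b) +
      C (n * (n + a + b + 1)) * jacobiPoly n a b = 0 := by
  set u := jacobiPoly n a b with hu
  have h : derivative (X * derivative u) + C a * derivative u -
      X * derivative (X * derivative u) - C (a + b + 1) * (X * derivative u) +
      C (n * (n + a + b + 1)) * u = 0 := by
    ext m
    have hrec := coeff_jacobiPoly_succ ha hab n m
    rw [← hu] at hrec
    simp only [coeff_add, coeff_sub, coeff_C_mul, coeff_X_mul_derivative, coeff_derivative,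
      coeff_zero]
    push_cast
    linear_combination hrec
  rw [← h]
  simp only [derivative_mul, derivative_X, C_add, C_1]
  ring

theorem derivative_jacobiPoly_succ {a b : ℝ} (hab : -1 < a + b) (n : ℕ) :
    derivative (jacobiPoly (n + 1) a b) =
      C (-(n + a + b + 2)) * jacobiPoly n (a + 1) (b + 1) := by
  ext m
  have hn : (0 : ℝ) ≤ n := n.cast_nonneg
  have hpos : 0 < a + b + n + 2 := by linarith
  have g := (Real.Gamma_pos_of_pos hpos).ne'
  have hf : (n.factorial : ℝ) ≠ 0 := by exact_mod_cast n.factorial_ne_zero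
  have hc : ((n + 1).choose (m + 1) : ℝ) * (m + 1) = (n + 1) * n.choose m := by
    exact_mod_cast (Nat.add_one_mul_choose_eq n m).symm
  have e : Real.Gamma (a + 1 + (b + 1) + n + 1) =
      (a + b + n + 2) * Real.Gamma (a + b + n + 2) := by
    rw [← Real.Gamma_add_one hpos.ne']; ring_nf
  rw [coeff_derivative, coeff_C_mul, coeff_jacobiPoly, coeff_jacobiPoly, e, Nat.factorial_succ]
  push_cast
  rw [show a + (n + 1) + 1 = a + 1 + n + 1 by ring, show a + (m + 1) + 1 = a + 1 + m + 1 by ring,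
    show a + b + (n + 1) + 1 = a + b + n + 2 by ring,
    show a + b + (n + 1) + (m + 1) + 1 = a + 1 + (b + 1) + n + m + 1 by ring, pow_succ]
  generalize Real.Gamma (a + 1 + (b + 1) + n + m + 1) / Real.Gamma (a + 1 + m + 1) = G
  have hn1 : (n + 1 : ℝ) ≠ 0 := by positivity
  field_simp
  linear_combination -(G * Real.Gamma (a + 1 + n + 1) * (a + b + n + 2)) * hc

/-- The energy identity for the Jacobi differential equation. -/
theorem betaMoment_derivative_sq {a b : ℝ} (ha : -1 < a) (hb : -1 < b) (hab : -1 < a + b) (n : ℕ) :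
    betaMoment a b (X * (1 - X) * derivative (jacobiPoly n a b) ^ 2) =
      n * (n + a + b + 1) * betaMoment a b (jacobiPoly n a b ^ 2) := by
  have h := betaMoment_integration_by_parts ha hb
    (derivative (jacobiPoly n a b) * jacobiPoly n a b)
  have ode := jacobiPoly_differential_equation ha hab n
  set u := jacobiPoly n a b
  have e : (C (a + 1) * (1 - X) - C (b + 1) * X) * (derivative u * u) +
      X * (1 - X) * derivative (derivative u * u) =
      X * (1 - X) * derivative u ^ 2 + C (-(n * (n + a + b + 1))) * u ^ 2 := by
    rw [derivative_mul, C_neg]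
    linear_combination u * ode
  rw [e, betaMoment_add ha hb, betaMoment_C_mul] at h
  linarith

theorem betaMoment_jacobiPoly_sq_succ {a b : ℝ} (ha : -1 < a) (hb : -1 < b) (hab : -1 < a + b)
    (n : ℕ) :
    betaMoment a b (jacobiPoly (n + 1) a b ^ 2) =
      (n + a + b + 2) / (n + 1) * betaMoment (a + 1) (b + 1) (jacobiPoly n (a + 1) (b + 1) ^ 2) := by
  have h := betaMoment_derivative_sq ha hb hab (n + 1)
  have hn : (0 : ℝ) ≤ n := n.cast_nonneg
  have hpos : (n + a + b + 2 : ℝ) ≠ 0 := by linarith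
  rw [betaMoment_X_mul_one_sub_X_mul, derivative_jacobiPoly_succ hab, mul_pow, ← C_pow,
    betaMoment_C_mul] at h
  push_cast at h
  have hn1 : (n + 1 : ℝ) ≠ 0 := by positivity
  field_simp
  refine mul_left_cancel₀ hpos ?_
  linear_combination -h

theorem jacobiPoly_zero {a b : ℝ} (ha : -1 < a) (hab : -1 < a + b) : jacobiPoly 0 a b = 1 := by
  have h1 := (Real.Gamma_pos_of_pos (show 0 < a + 1 by linarith)).ne'
  have h2 := (Real.Gamma_pos_of_pos (show 0 < a + b + 1 by linarith)).ne'
  simp only [jacobiPoly, zero_add, Finset.sum_range_one, Nat.cast_zero, add_zero,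
    Nat.factorial_zero, Nat.choose_self, Nat.cast_one, one_mul, pow_zero, mul_one]
  rw [div_mul_div_cancel₀ h2, div_self h1, C_1]

/-- The squared norm of the Jacobi polynomials. -/
theorem betaMoment_jacobiPoly_sq (n : ℕ) {a b : ℝ} (ha : -1 < a) (hb : -1 < b)
    (hab : -1 < a + b) :
    betaMoment a b (jacobiPoly n a b ^ 2) =
      Real.Gamma (n + a + 1) * Real.Gamma (n + b + 1) /
        ((2 * n + a + b + 1) * n.factorial * Real.Gamma (n + a + b + 1)) := by
  induction n generalizing a b with
  | zero =>
    rw [jacobiPoly_zero ha hab, one_pow, betaMoment_one ha hb,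
      show a + b + 2 = a + b + 1 + 1 by ring,
      Real.Gamma_add_one (show a + b + 1 ≠ 0 by linarith)]
    simp
  | succ n ih =>
    have hn : (0 : ℝ) ≤ n := n.cast_nonneg
    have hpos : 0 < n + a + b + 2 := by linarith
    rw [betaMoment_jacobiPoly_sq_succ ha hb hab,
      ih (by linarith) (by linarith) (by linarith), Nat.factorial_succ]
    have e : Real.Gamma (n + (a + 1) + (b + 1) + 1) =
        (n + a + b + 2) * Real.Gamma (n + a + b + 2) := by
      rw [← Real.Gamma_add_one hpos.ne']; ring_nf
    have g := (Real.Gamma_pos_of_pos hpos).ne'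
    have hf : (n.factorial : ℝ) ≠ 0 := by exact_mod_cast n.factorial_ne_zero
    have hd : 0 < 2 * n + a + b + 3 := by linarith
    rw [e]
    push_cast
    rw [show (n : ℝ) + 1 + a + 1 = n + (a + 1) + 1 by ring,
      show (n : ℝ) + 1 + b + 1 = n + (b + 1) + 1 by ring,
      show (n : ℝ) + 1 + a + b + 1 = n + a + b + 2 by ring,
      show 2 * (n : ℝ) + (a + 1) + (b + 1) + 1 = 2 * n + a + b + 3 by ring,
      show 2 * ((n : ℝ) + 1) + a + b + 1 = 2 * n + a + b + 3 by ring]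
    field_simp

theorem exists_gamma_ratio_le {a b : ℝ} (ha : -1 < a) (hb : -1 < b) (hab : -1 < a + b) :
    ∃ C : ℝ, 0 < C ∧ ∀ n : ℕ, 1 ≤ n →
      Real.Gamma (n + a + 1) * Real.Gamma (n + b + 1) /
        (n.factorial * Real.Gamma (n + a + b + 1)) ≤ C := by
  set R : ℕ → ℝ := fun n => Real.Gamma (n + a + 1) * Real.Gamma (n + b + 1) /
    (n.factorial * Real.Gamma (n + a + b + 1)) with hR
  have R_pos (n : ℕ) : 0 < R n := by
    have hn : (0 : ℝ) ≤ n := n.cast_nonneg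
    have h1 := Real.Gamma_pos_of_pos (show 0 < n + a + 1 by linarith)
    have h2 := Real.Gamma_pos_of_pos (show 0 < n + b + 1 by linarith)
    have h3 := Real.Gamma_pos_of_pos (show 0 < n + a + b + 1 by linarith)
    have hf : (0 : ℝ) < n.factorial := by exact_mod_cast n.factorial_pos
    exact div_pos (mul_pos h1 h2) (mul_pos hf h3)
  have R_succ (n : ℕ) : R (n + 1) = (1 + a * b / ((n + 1) * (n + a + b + 1))) * R n := by
    have hn : (0 : ℝ) ≤ n := n.cast_nonneg
    have h1 : 0 < n + a + 1 := by linarith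
    have h2 : 0 < n + b + 1 := by linarith
    have h3 : 0 < n + a + b + 1 := by linarith
    have g3 := (Real.Gamma_pos_of_pos h3).ne'
    have hf : (n.factorial : ℝ) ≠ 0 := by exact_mod_cast n.factorial_ne_zero
    simp only [hR, Nat.factorial_succ]
    push_cast
    rw [show (n : ℝ) + 1 + a + 1 = n + a + 1 + 1 by ring,
      show (n : ℝ) + 1 + b + 1 = n + b + 1 + 1 by ring,
      show (n : ℝ) + 1 + a + b + 1 = n + a + b + 1 + 1 by ring,
      Real.Gamma_add_one h1.ne', Real.Gamma_add_one h2.ne', Real.Gamma_add_one h3.ne']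
    field_simp
    ring
  set A : ℝ := |a * b| with hA
  have bound (n : ℕ) (hn : 1 ≤ n) : R n ≤ R 1 * Real.exp (A - A / n) := by
    induction n, hn using Nat.le_induction with
    | base => simp
    | succ n hn ih =>
      have hn' : (1 : ℝ) ≤ n := by exact_mod_cast hn
      have step : 1 + a * b / ((n + 1) * (n + a + b + 1)) ≤ Real.exp (A / n - A / (n + 1)) := by
        refine le_trans ?_ (Real.add_one_le_exp _)
        have e : A / n - A / (n + 1) = A / ((n + 1) * n) := by field_simp; ring
        rw [e, add_comm]
        have h4 : (0 : ℝ) < n + a + b + 1 := by linarith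
        have : a * b / ((n + 1) * (n + a + b + 1)) ≤ A / ((n + 1) * n) :=
          calc a * b / ((n + 1) * (n + a + b + 1)) ≤ A / ((n + 1) * (n + a + b + 1)) := by
                gcongr; exact le_abs_self _
            _ ≤ A / ((n + 1) * n) := by gcongr; linarith
        linarith
      calc R (n + 1) = (1 + a * b / ((n + 1) * (n + a + b + 1))) * R n := R_succ n
        _ ≤ Real.exp (A / n - A / (n + 1)) * (R 1 * Real.exp (A - A / n)) :=
            mul_le_mul step ih (R_pos n).le (Real.exp_pos _).le
        _ = R 1 * Real.exp (A - A / (n + 1 : ℕ)) := by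
            rw [mul_left_comm, ← Real.exp_add]
            push_cast
            ring_nf
  refine ⟨R 1 * Real.exp A, mul_pos (R_pos 1) (Real.exp_pos _), fun n hn => ?_⟩
  refine (bound n hn).trans ?_
  have := (R_pos 1).le
  have : 0 ≤ A / n := div_nonneg (abs_nonneg _) n.cast_nonneg
  gcongr
  linarith

theorem exists_betaMoment_jacobiPoly_sq_le {a b : ℝ} (ha : -1 < a) (hb : -1 < b)
    (hab : -1 < a + b) :
    ∃ C : ℝ, 0 < C ∧ ∀ n : ℕ, 1 ≤ n →
      betaMoment a b (jacobiPoly n a b ^ 2) ≤ C / (n + 1) := by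
  obtain ⟨K, hK, h⟩ := exists_gamma_ratio_le ha hb hab
  refine ⟨2 * K, by positivity, fun n hn => ?_⟩
  have hn' : (1 : ℝ) ≤ n := by exact_mod_cast hn
  have hd : 0 < 2 * n + a + b + 1 := by linarith
  rw [betaMoment_jacobiPoly_sq n ha hb hab, mul_assoc (2 * (n : ℝ) + a + b + 1),
    mul_comm (2 * (n : ℝ) + a + b + 1),
    ← div_div]
  calc _ ≤ K / (2 * n + a + b + 1) := by gcongr; exact h n hn
    _ ≤ 2 * K / (n + 1) := by
      rw [div_le_div_iff₀ hd (by positivity)]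
      nlinarith

/-- The moments of `u ^ 2`, `u` a Jacobi polynomial, against the squared weight, localized away
from the critical point of `s ^ (2 * a + 1) * (1 - s) ^ (2 * b + 1)`, are controlled by its norm. -/
theorem betaMoment_sub_sq_mul_jacobiPoly_sq_le {a b : ℝ} (ha : -(1 / 2) < a) (hb : -(1 / 2) < b)
    {n : ℕ} (hn : 1 ≤ n) :
    (a + b + 1) * betaMoment (2 * a) (2 * b)
        ((C ((2 * a + 1) / (2 * a + 2 * b + 2)) - X) ^ 2 * jacobiPoly n a b ^ 2) ≤
      betaMoment a b (jacobiPoly n a b ^ 2) := by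
  have ha1 : -1 < a := by linarith
  have hb1 : -1 < b := by linarith
  have ha2 : -1 < 2 * a := by linarith
  have hb2 : -1 < 2 * b := by linarith
  have hn' : (1 : ℝ) ≤ n := by exact_mod_cast hn
  have ode := jacobiPoly_differential_equation ha1 (by linarith : -1 < a + b) n
  have energy := betaMoment_derivative_sq ha1 hb1 (by linarith) n
  set u := jacobiPoly n a b
  set c := (2 * a + 1) / (2 * a + 2 * b + 2) with hc
  set lam : ℝ := n * (n + a + b + 1) with hlam
  have lam_pos : 0 < lam := mul_pos (by linarith) (by linarith)
  have parts := betaMoment_integration_by_parts ha2 hb2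
    ((C c - X) * (X * (1 - X) * derivative u ^ 2 + C lam * u ^ 2))
  have hKc : 2 * a + 1 = (2 * a + 2 * b + 2) * c := by
    rw [hc, mul_div_cancel₀ _ (by linarith)]
  have hKc' : (2 * C a + 1 : ℝ[X]) = (2 * C a + 2 * C b + 2) * C c := by
    have := congrArg C hKc
    simpa only [C_add, C_mul, C_1, map_ofNat] using this
  have e : (C (2 * a + 1) * (1 - X) - C (2 * b + 1) * X) *
        ((C c - X) * (X * (1 - X) * derivative u ^ 2 + C lam * u ^ 2)) +
      X * (1 - X) * derivative ((C c - X) * (X * (1 - X) * derivative u ^ 2 + C lam * u ^ 2)) =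
      C ((2 * a + 2 * b + 2) * lam) * ((C c - X) ^ 2 * u ^ 2) +
      C (-1) * (X * (1 - X) * (X * (1 - X) * derivative u ^ 2 + C lam * u ^ 2)) := by
    simp only [C_add, C_mul, C_1, derivative_mul, derivative_sub, derivative_add, derivative_C,
      derivative_X, derivative_one, derivative_pow, C_neg, map_ofNat, Nat.cast_ofNat] at ode ⊢
    linear_combination (2 * X * (1 - X) * (C c - X) * derivative u) * ode +
      ((C c - X) * (X * (1 - X) * derivative u ^ 2 + C lam * u ^ 2) -
        X * (1 - X) * (C c - X) * derivative u ^ 2) * hKc'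
  rw [e, betaMoment_add ha2 hb2, betaMoment_C_mul, betaMoment_C_mul] at parts
  have compare : betaMoment (2 * a) (2 * b)
        (X * (1 - X) * (X * (1 - X) * derivative u ^ 2 + C lam * u ^ 2)) ≤
      betaMoment a b (X * (1 - X) * derivative u ^ 2 + C lam * u ^ 2) := by
    refine betaMoment_le_betaMoment ha2 hb2 ha1 hb1 fun s hs => ?_
    have h0 : 0 < s := hs.1
    have h1 : 0 < 1 - s := by linarith [hs.2]
    have hw : s ^ (2 * a) * (1 - s) ^ (2 * b) * (s * (1 - s)) =
        s ^ a * (1 - s) ^ b * (s ^ (a + 1) * (1 - s) ^ (b + 1)) := by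
      rw [two_mul, two_mul, Real.rpow_add h0, Real.rpow_add h1, Real.rpow_add_one h0.ne',
        Real.rpow_add_one h1.ne']
      ring
    simp only [eval_mul, eval_add, eval_sub, eval_X, eval_one, eval_pow, eval_C]
    rw [← mul_assoc, hw]
    have i0 : s ^ (a + 1) ≤ 1 := Real.rpow_le_one h0.le hs.2.le (by linarith)
    have i1 : (1 - s) ^ (b + 1) ≤ 1 := Real.rpow_le_one h1.le (by linarith) (by linarith)
    have p0 := Real.rpow_nonneg h0.le a
    have p1 := Real.rpow_nonneg h1.le b
    have q1 := Real.rpow_nonneg h1.le (b + 1)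
    refine mul_le_mul_of_nonneg_right ?_ (by positivity)
    exact mul_le_of_le_one_right (by positivity) (mul_le_one₀ i0 q1 i1)
  rw [betaMoment_add ha1 hb1, energy, betaMoment_C_mul] at compare
  refine le_of_mul_le_mul_left ?_ lam_pos
  linarith

/-- The squared beta weight is controlled by its product with `(c - s) ^ 2` and by the weight. -/
theorem exists_sq_weight_le {a b c : ℝ} (ha : -1 < a) (hb : -1 < b) (hc0 : 0 < c) (hc1 : c < 1) :
    ∃ D : ℝ, 0 < D ∧ ∀ s ∈ Set.Ioo (0 : ℝ) 1,
      s ^ (2 * a) * (1 - s) ^ (2 * b) ≤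
        D * (s ^ (2 * a) * (1 - s) ^ (2 * b) * (c - s) ^ 2 + s ^ a * (1 - s) ^ b) := by
  obtain ⟨d, hd, hdc, hdc'⟩ : ∃ d : ℝ, 0 < d ∧ 2 * d ≤ c ∧ 2 * d ≤ 1 - c :=
    ⟨min c (1 - c) / 2, half_pos (lt_min hc0 (by linarith)),
      by linarith [min_le_left c (1 - c)], by linarith [min_le_right c (1 - c)]⟩
  refine ⟨(d ^ 2)⁻¹, by positivity, fun s hs => ?_⟩
  have h0 : 0 < s := hs.1
  have h1 : 0 < 1 - s := by linarith [hs.2]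
  have p0 := Real.rpow_nonneg h0.le a
  have p1 := Real.rpow_nonneg h1.le b
  have hw : s ^ (2 * a) * (1 - s) ^ (2 * b) = (s ^ a * (1 - s) ^ b) * (s ^ a * (1 - s) ^ b) := by
    rw [two_mul, two_mul, Real.rpow_add h0, Real.rpow_add h1]
    ring
  rw [hw, inv_mul_eq_div, le_div_iff₀ (by positivity)]
  have hw0 : 0 ≤ s ^ a * (1 - s) ^ b := by positivity
  rcases le_or_gt d |c - s| with h | h
  · have : d ^ 2 ≤ (c - s) ^ 2 := by
      rw [← sq_abs (c - s)]; gcongr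
    nlinarith [mul_le_mul_of_nonneg_left this (mul_nonneg hw0 hw0)]
  · have rpow_le {t e : ℝ} (ht : d ≤ t) (ht1 : t ≤ 1) (he : -1 < e) : t ^ e ≤ d⁻¹ := by
      have ht0 : 0 < t := hd.trans_le ht
      calc t ^ e ≤ t ^ (-1 : ℝ) := Real.rpow_le_rpow_of_exponent_ge ht0 ht1 he.le
        _ = t⁻¹ := Real.rpow_neg_one t
        _ ≤ d⁻¹ := inv_anti₀ hd ht
    rw [abs_lt] at h
    have hle : s ^ a * (1 - s) ^ b * d ^ 2 ≤ 1 := by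
      have := mul_le_mul (rpow_le (t := s) (by linarith) hs.2.le ha)
        (rpow_le (t := 1 - s) (by linarith) (by linarith) hb) p1 (by positivity)
      calc s ^ a * (1 - s) ^ b * d ^ 2 ≤ d⁻¹ * d⁻¹ * d ^ 2 := by gcongr
        _ = 1 := by field_simp
    nlinarith [mul_le_mul_of_nonneg_left hle hw0,
      mul_nonneg (mul_nonneg hw0 hw0) (sq_nonneg (c - s))]

theorem exists_betaMoment_sq_weight_le {a b : ℝ} (ha : -(1 / 2) < a) (hb : -(1 / 2) < b) :
    ∃ D : ℝ, 0 < D ∧ ∀ n : ℕ,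
      betaMoment (2 * a) (2 * b) (jacobiPoly n a b ^ 2) ≤ D / (n + 1) := by
  have ha1 : -1 < a := by linarith
  have hb1 : -1 < b := by linarith
  have ha2 : -1 < 2 * a := by linarith
  have hb2 : -1 < 2 * b := by linarith
  have hK : 0 < 2 * a + 2 * b + 2 := by linarith
  set c := (2 * a + 1) / (2 * a + 2 * b + 2) with hc
  obtain ⟨D, hD, hweight⟩ := exists_sq_weight_le ha1 hb1 (c := c)
    (div_pos (by linarith) hK) ((div_lt_one hK).2 (by linarith))
  obtain ⟨M, hM, hnorm⟩ := exists_betaMoment_jacobiPoly_sq_le ha1 hb1 (by linarith)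
  have hk : 0 < a + b + 1 := by linarith
  set B := D * ((a + b + 1)⁻¹ + 1) * M with hB
  have hB0 : 0 < B := by positivity
  set Z := betaMoment (2 * a) (2 * b) (jacobiPoly 0 a b ^ 2) with hZ
  refine ⟨max B Z, lt_max_of_lt_left hB0, fun n => ?_⟩
  rcases Nat.eq_zero_or_pos n with rfl | hn
  · simpa using Or.inr hZ.ge
  have far := betaMoment_sub_sq_mul_jacobiPoly_sq_le ha hb hn
  have hle : betaMoment (2 * a) (2 * b) (jacobiPoly n a b ^ 2) ≤
      D * betaMoment (2 * a) (2 * b) ((C c - X) ^ 2 * jacobiPoly n a b ^ 2) +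
        D * betaMoment a b (jacobiPoly n a b ^ 2) := by
    rw [betaMoment, betaMoment, betaMoment, ← intervalIntegral.integral_const_mul,
      ← intervalIntegral.integral_const_mul, ← intervalIntegral.integral_add
        ((intervalIntegrable_beta_mul_eval ha2 hb2 _).const_mul D)
        ((intervalIntegrable_beta_mul_eval ha1 hb1 _).const_mul D)]
    refine intervalIntegral.integral_mono_on_of_le_Ioo zero_le_one
      (intervalIntegrable_beta_mul_eval ha2 hb2 _)
      (((intervalIntegrable_beta_mul_eval ha2 hb2 _).const_mul D).add
        ((intervalIntegrable_beta_mul_eval ha1 hb1 _).const_mul D)) fun s hs => ?_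
    simp only [eval_mul, eval_sub, eval_pow, eval_C, eval_X]
    linarith [mul_le_mul_of_nonneg_right (hweight s hs) (sq_nonneg ((jacobiPoly n a b).eval s))]
  have hn1 : (0 : ℝ) < n + 1 := by positivity
  rw [mul_comm, ← le_div_iff₀ hk] at far
  calc _ ≤ D * (betaMoment a b (jacobiPoly n a b ^ 2) / (a + b + 1)) +
        D * betaMoment a b (jacobiPoly n a b ^ 2) := by grw [hle, far]
    _ = D * ((a + b + 1)⁻¹ + 1) * betaMoment a b (jacobiPoly n a b ^ 2) := by
        field_simp
    _ ≤ D * ((a + b + 1)⁻¹ + 1) * (M / (n + 1)) := by gcongr; exact hnorm n hn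
    _ = B / (n + 1) := by rw [hB]; ring
    _ ≤ max B Z / (n + 1) := by gcongr; exact le_max_left _ _

theorem betaMoment_sq_pos {p r : ℝ} (hp : -1 < p) (hr : -1 < r) {q : ℝ[X]} (hq : q ≠ 0) :
    0 < betaMoment p r (q ^ 2) := by
  have nonneg : ∀ s ∈ Set.Ioc (0 : ℝ) 1, 0 ≤ s ^ p * (1 - s) ^ r * (q ^ 2).eval s := by
    intro s hs
    rw [eval_pow]
    exact mul_nonneg (mul_nonneg (Real.rpow_nonneg hs.1.le _)
      (Real.rpow_nonneg (by linarith [hs.2]) _)) (sq_nonneg _)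
  rw [betaMoment, intervalIntegral.integral_pos_iff_support_of_nonneg_ae' _
    (intervalIntegrable_beta_mul_eval hp hr (q ^ 2))]
  · refine ⟨zero_lt_one, ?_⟩
    have hsub : Set.Ioo (0 : ℝ) 1 \ {s | q.IsRoot s} ⊆
        Function.support (fun s : ℝ => s ^ p * (1 - s) ^ r * (q ^ 2).eval s) ∩ Set.Ioc 0 1 := by
      rintro s ⟨hs, hroot⟩
      refine ⟨?_, hs.1, hs.2.le⟩
      rw [Function.mem_support, eval_pow]
      exact mul_ne_zero (mul_ne_zero (Real.rpow_pos_of_pos hs.1 _).ne'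
        (Real.rpow_pos_of_pos (by linarith [hs.2]) _).ne') (pow_ne_zero 2 hroot)
    refine lt_of_lt_of_le ?_ (MeasureTheory.measure_mono hsub)
    rw [MeasureTheory.measure_sdiff_null ((finite_setOfPred_isRoot hq).measure_zero _)]
    simp
  · rw [Set.uIoc_of_le zero_le_one]
    exact MeasureTheory.ae_restrict_of_forall_mem measurableSet_Ioc nonneg

theorem integral_eval_mul_jacobiW_sq (a b : ℝ) (q : ℝ[X]) :
    ∫ t in (-1 : ℝ)..1, q.eval ((1 - t) / 2) * jacobiW a b t ^ 2 =
      2 * (2 ^ a * 2 ^ b) ^ 2 * betaMoment (2 * a) (2 * b) q := by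
  have h := intervalIntegral.integral_comp_sub_div (a := -1) (b := 1)
    (fun s : ℝ => (2 ^ a * 2 ^ b) ^ 2 * (s ^ (2 * a) * (1 - s) ^ (2 * b) * q.eval s))
    (two_ne_zero' ℝ) (1 / 2)
  norm_num only [smul_eq_mul] at h
  rw [betaMoment, mul_assoc, ← intervalIntegral.integral_const_mul, ← h]
  refine intervalIntegral.integral_congr fun t ht => ?_
  rw [Set.uIcc_of_le (by norm_num)] at ht
  have h0 : 0 ≤ (1 - t) / 2 := by linarith [ht.2]
  have h1 : 0 ≤ (1 + t) / 2 := by linarith [ht.1]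
  have sq_rpow {y : ℝ} (hy : 0 ≤ y) (e : ℝ) : y ^ (2 * e) = (y ^ e) ^ 2 := by
    rw [mul_comm]; exact_mod_cast Real.rpow_mul_natCast hy e 2
  simp only [jacobiW]
  rw [show 1 - t = 2 * ((1 - t) / 2) by ring, show 1 + t = 2 * ((1 + t) / 2) by ring,
    Real.mul_rpow zero_le_two h0, Real.mul_rpow zero_le_two h1,
    show 1 / 2 - t / 2 = (1 - t) / 2 by ring, show 1 - (1 - t) / 2 = (1 + t) / 2 by ring,
    sq_rpow h0, sq_rpow h1, show 2 * ((1 - t) / 2) / 2 = (1 - t) / 2 by ring]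
  ring

theorem gramG_apply (a b : ℝ) {N : ℕ} (i j : Fin N) :
    gramG a b N i j = 2 * (2 ^ a * 2 ^ b) ^ 2 *
      betaMoment (2 * a) (2 * b) (jacobiPoly i a b * jacobiPoly j a b) := by
  rw [← integral_eval_mul_jacobiW_sq]
  simp only [gramG, Matrix.of_apply, jacobiP_eq_eval_jacobiPoly, eval_mul]

theorem gramG_isSymm (a b : ℝ) (N : ℕ) : (gramG a b N).IsSymm := by
  refine Matrix.IsSymm.ext fun i j => ?_
  rw [gramG_apply, gramG_apply, mul_comm (jacobiPoly _ a b)]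

theorem sum_C_mul_jacobiPoly_ne_zero {a b : ℝ} (ha : -1 < a) (hab : -1 < a + b) {N : ℕ}
    {v : Fin N → ℝ} (hv : v ≠ 0) : ∑ i, C (v i) * jacobiPoly i a b ≠ 0 := by
  let S : Polynomial.Sequence ℝ := ⟨fun n => jacobiPoly n a b, degree_jacobiPoly ha hab⟩
  have hS : LinearIndependent ℝ (fun i : Fin N => jacobiPoly i a b) :=
    S.linearIndependent.comp _ Fin.val_injective
  intro h
  refine hv (funext (Fintype.linearIndependent_iff.1 hS v ?_))
  simpa only [smul_eq_C_mul] using h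

theorem gramG_posDef {a b : ℝ} (ha : -(1 / 2) < a) (hb : -(1 / 2) < b) (N : ℕ) :
    (gramG a b N).PosDef := by
  have ha2 : -1 < 2 * a := by linarith
  have hb2 : -1 < 2 * b := by linarith
  refine .of_dotProduct_mulVec_pos ?_ fun v hv => ?_
  · rw [Matrix.IsHermitian, Matrix.conjTranspose_eq_transpose_of_trivial]
    exact gramG_isSymm a b N
  have hpos := betaMoment_sq_pos ha2 hb2
    (sum_C_mul_jacobiPoly_ne_zero (by linarith) (by linarith : -1 < a + b) hv)
  have e : star v ⬝ᵥ (gramG a b N).mulVec v = 2 * (2 ^ a * 2 ^ b) ^ 2 *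
      betaMoment (2 * a) (2 * b) ((∑ i, C (v i) * jacobiPoly i a b) ^ 2) := by
    rw [sq (∑ i, _), Finset.sum_mul_sum, betaMoment_sum ha2 hb2]
    simp only [betaMoment_sum ha2 hb2, dotProduct, Matrix.mulVec, gramG_apply, Pi.star_apply,
      star_trivial, Finset.mul_sum]
    refine Finset.sum_congr rfl fun i _ => Finset.sum_congr rfl fun j _ => ?_
    rw [mul_mul_mul_comm, ← C_mul, betaMoment_C_mul]
    ring
  rw [e]
  positivity

theorem le_trace_of_mem_spectrum {n : Type*} [Fintype n] [DecidableEq n] {A : Matrix n n ℝ}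
    (hA : A.PosSemidef) {μ : ℝ} (hμ : μ ∈ spectrum ℝ A) : μ ≤ A.trace := by
  rw [hA.1.spectrum_real_eq_range_eigenvalues] at hμ
  obtain ⟨i, rfl⟩ := hμ
  rw [hA.1.trace_eq_sum_eigenvalues]
  exact Finset.single_le_sum (f := hA.1.eigenvalues) (fun j _ => hA.eigenvalues_nonneg j)
    (Finset.mem_univ i)

theorem sum_fin_inv_le_one_add_log (N : ℕ) :
    ∑ i : Fin N, ((i : ℝ) + 1)⁻¹ ≤ 1 + Real.log N := by
  refine le_trans (le_of_eq ?_) (harmonic_le_one_add_log N)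
  rw [Fin.sum_univ_eq_sum_range (fun i => ((i : ℝ) + 1)⁻¹), harmonic]
  push_cast
  rfl

end

/-- For `α, β > -1/2`, the Gram matrix `G̃_N` is symmetric positive definite and its largest
eigenvalue grows at most logarithmically: every eigenvalue is at most `C(1 + log N)`. -/
theorem gram_posdef_and_eigenvalue_bound (α β : ℝ)
    (hα : -(1 / 2 : ℝ) < α) (hβ : -(1 / 2 : ℝ) < β) :
    ∃ C : ℝ, 0 < C ∧ ∀ N : ℕ, 1 ≤ N →
      (gramG α β N).IsSymm ∧ (gramG α β N).PosDef ∧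
      ∀ μ ∈ spectrum ℝ (gramG α β N), μ ≤ C * (1 + Real.log N) := by
  obtain ⟨D, hD, hdiag⟩ := exists_betaMoment_sq_weight_le hα hβ
  refine ⟨2 * (2 ^ α * 2 ^ β) ^ 2 * D, by positivity, fun N _ =>
    ⟨gramG_isSymm α β N, gramG_posDef hα hβ N, fun μ hμ => ?_⟩⟩
  calc μ ≤ (gramG α β N).trace := le_trace_of_mem_spectrum (gramG_posDef hα hβ N).posSemidef hμ
    _ ≤ ∑ i : Fin N, 2 * (2 ^ α * 2 ^ β) ^ 2 * D * ((i : ℝ) + 1)⁻¹ := by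
        refine Finset.sum_le_sum fun i _ => ?_
        rw [Matrix.diag_apply, gramG_apply, ← sq, mul_assoc _ D, ← div_eq_mul_inv]
        gcongr
        exact hdiag i
    _ ≤ 2 * (2 ^ α * 2 ^ β) ^ 2 * D * (1 + Real.log N) := by
        rw [← Finset.mul_sum]
        gcongr
        exact sum_fin_inv_le_one_add_log N
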